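/- arXiv:2207.12719 — 6 statements merged into one kernel-verified Lean document; each statement's English description precedes it below -/
import Mathlib

section
/- Let C ⊆ M³ˣ³_sym be a nonempty closed convex set that is insensitive to hydrostatic pressure, let λ > 0, μ > 0 and H(τ) = 2μτ + λ tr(τ)I. Then for all τ ∈ M³ˣ³_sym and η ∈ C: P_{T_C(η)}(H(τ)) = H(P_{T_C(η)}(τ)), and P_{N_C(η)}(H(τ)) = H(P_{N_C(η)}(τ)) = 2μ · P_{N_C(η)}(τ). -/
open Matrix

/-- The space of 3×3 real matrices (we single out the symmetric ones by `Matrix.IsSymm`). -/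
abbrev Mat3 := Matrix (Fin 3) (Fin 3) ℝ

/-- The Frobenius inner product on symmetric matrices: `σ:τ = tr(στ)`. -/
noncomputable def minner (A B : Mat3) : ℝ := (A * B).trace

/-- The Frobenius norm `‖A‖ = (A:A)^{1/2}` on symmetric matrices. -/
noncomputable def mnorm (A : Mat3) : ℝ := Real.sqrt (minner A A)

/-- `p` is the metric (orthogonal) projection of `z` onto `K`. -/
def IsProjOn (K : Set Mat3) (z p : Mat3) : Prop :=
  p ∈ K ∧ ∀ w ∈ K, mnorm (z - p) ≤ mnorm (z - w)

/-- The tangent cone of a convex set `C` at `σ`. -/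
def tangentCone (C : Set Mat3) (σ : Mat3) : Set Mat3 :=
  closure {τ | ∃ η ∈ C, ∃ α : ℝ, 0 < α ∧ τ = α • (η - σ)}

/-- The normal cone of a convex set `C ⊆ M³ˣ³_sym` at `σ`. -/
def normalCone (C : Set Mat3) (σ : Mat3) : Set Mat3 :=
  {n | n.IsSymm ∧ ∀ τ ∈ tangentCone C σ, minner n τ ≤ 0}

/-- The Hooke (isotropic elasticity) operator `H(τ) = 2μτ + λ tr(τ) I`. -/
noncomputable def hooke (lam mu : ℝ) (τ : Mat3) : Mat3 :=
  (2 * mu) • τ + (lam * τ.trace) • (1 : Mat3)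

lemma aux_minner_nonneg {A : Mat3} (h : A.IsSymm) : 0 ≤ minner A A := by
  have h1 := h.apply 0 1
  have h2 := h.apply 0 2
  have h3 := h.apply 1 2
  simp only [minner, Matrix.trace, Matrix.mul_apply, Fin.sum_univ_three, Matrix.diag_apply, h1, h2, h3]
  nlinarith [sq_nonneg (A 0 0), sq_nonneg (A 1 1), sq_nonneg (A 2 2), sq_nonneg (A 0 1),
    sq_nonneg (A 0 2), sq_nonneg (A 1 2)]

lemma aux_minner_add (A : Mat3) (a c : ℝ) :
    minner (a • A + c • (1 : Mat3)) (a • A + c • (1 : Mat3)) =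
      a ^ 2 * minner A A + 2 * a * c * A.trace + 3 * c ^ 2 := by
  simp only [minner, Matrix.trace, Matrix.mul_apply, Fin.sum_univ_three, Matrix.diag_apply,
    Matrix.add_apply, Matrix.smul_apply, smul_eq_mul, Matrix.one_apply]
  simp
  ring

lemma aux_le {A B : Mat3} (hB : B.IsSymm) (h : mnorm A ≤ mnorm B) : minner A A ≤ minner B B :=
  (Real.sqrt_le_sqrt_iff (aux_minner_nonneg hB)).1 h

lemma aux_T_symm {C : Set Mat3} (hC : ∀ A ∈ C, A.IsSymm) {η : Mat3} (hη : η ∈ C) {w : Mat3}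
    (hw : w ∈ tangentCone C η) : w.IsSymm := by
  have hcl : IsClosed {A : Mat3 | A.IsSymm} := by
    simp only [Matrix.IsSymm]
    exact isClosed_eq (by fun_prop) continuous_id
  refine closure_minimal ?_ hcl hw
  rintro _ ⟨ξ, hξ, α, _, rfl⟩
  exact ((hC ξ hξ).sub (hC η hη)).smul α

lemma aux_T_aff {C : Set Mat3} (hh : ∀ A ∈ C, ∀ p : ℝ, A + p • (1 : Mat3) ∈ C) {η w : Mat3}
    (hw : w ∈ tangentCone C η) {a : ℝ} (ha : 0 < a) (c : ℝ) :
    a • w + c • (1 : Mat3) ∈ tangentCone C η := by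
  have hf : Continuous (fun A : Mat3 => a • A + c • (1 : Mat3)) := by fun_prop
  refine map_mem_closure (f := fun A : Mat3 => a • A + c • (1 : Mat3)) hf hw ?_
  rintro _ ⟨ξ, hξ, α, hα, rfl⟩
  dsimp only
  refine ⟨ξ + (c / (a * α)) • (1 : Mat3), hh ξ hξ _, a * α, by positivity, ?_⟩
  have : a * α * (c / (a * α)) = c := by field_simp
  rw [add_sub_right_comm, smul_add, smul_smul, smul_smul, this]

lemma aux_N_trace {C : Set Mat3} (hh : ∀ A ∈ C, ∀ p : ℝ, A + p • (1 : Mat3) ∈ C) {η n : Mat3}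
    (hη : η ∈ C) (hn : n ∈ normalCone C η) : n.trace = 0 := by
  have key : ∀ p : ℝ, p * n.trace ≤ 0 := by
    intro p
    have hm : p • (1 : Mat3) ∈ tangentCone C η :=
      subset_closure ⟨η + p • (1 : Mat3), hh η hη p, 1, one_pos, by simp⟩
    have := hn.2 _ hm
    simpa [minner] using this
  linarith [key 1, key (-1)]

lemma aux_N_smul {C : Set Mat3} {η n : Mat3}
    (hn : n ∈ normalCone C η) {a : ℝ} (ha : 0 < a) : a • n ∈ normalCone C η := by
  refine ⟨hn.1.smul a, fun t ht => ?_⟩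
  have h1 := hn.2 t ht
  have h2 : minner (a • n) t = a * minner n t := by simp [minner]
  rw [h2]
  exact mul_nonpos_of_nonneg_of_nonpos ha.le h1

/-- The Hooke operator commutes with the projections on the tangent and normal cones;
on the normal cone it acts as multiplication by `2μ`. -/
theorem stmt2 (C : Set Mat3)
    (hCsym : ∀ A ∈ C, A.IsSymm) (hne : C.Nonempty) (hcl : IsClosed C) (hconv : Convex ℝ C)
    (hhydro : ∀ A ∈ C, ∀ p : ℝ, A + p • (1 : Mat3) ∈ C)
    (lam mu : ℝ) (hlam : 0 < lam) (hmu : 0 < mu)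
    (τ : Mat3) (hτ : τ.IsSymm) (η : Mat3) (hη : η ∈ C) :
    (∀ pT : Mat3, IsProjOn (tangentCone C η) τ pT →
        IsProjOn (tangentCone C η) (hooke lam mu τ) (hooke lam mu pT)) ∧
    (∀ pN : Mat3, IsProjOn (normalCone C η) τ pN →
        IsProjOn (normalCone C η) (hooke lam mu τ) (hooke lam mu pN) ∧
        hooke lam mu pN = (2 * mu) • pN) := by
  have ha : 0 < 2 * mu := by positivity
  have hane : 2 * mu ≠ 0 := ha.ne'
  constructor
  · rintro p ⟨hp, hmin⟩
    have hps := aux_T_symm hCsym hη hp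
    have htr : (τ - p).trace = 0 := by
      have hm := aux_T_aff hhydro hp one_pos ((τ - p).trace / 3)
      have h1 := aux_le (hτ.sub (aux_T_symm hCsym hη hm)) (hmin _ hm)
      have e : τ - ((1 : ℝ) • p + ((τ - p).trace / 3) • (1 : Mat3)) =
          (1 : ℝ) • (τ - p) + (-((τ - p).trace / 3)) • (1 : Mat3) := by module
      rw [e, aux_minner_add] at h1
      nlinarith [sq_nonneg ((τ - p).trace)]
    refine ⟨aux_T_aff hhydro hp ha _, fun w hw => ?_⟩
    have hm := aux_T_aff hhydro hw (inv_pos.2 ha) (-((2 * mu)⁻¹ * (lam * τ.trace)))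
    have h1 := aux_le (hτ.sub (aux_T_symm hCsym hη hm)) (hmin _ hm)
    have htr' : p.trace = τ.trace := by rw [Matrix.trace_sub] at htr; linarith
    have e1 : hooke lam mu τ - hooke lam mu p = (2 * mu) • (τ - p) + (0 : ℝ) • (1 : Mat3) := by
      simp only [hooke, htr']; module
    have e2 : hooke lam mu τ - w = (2 * mu) • (τ - ((2 * mu)⁻¹ • w +
        (-((2 * mu)⁻¹ * (lam * τ.trace))) • (1 : Mat3))) + (0 : ℝ) • (1 : Mat3) := by
      simp only [hooke]
      match_scalars <;> field_simp <;> ring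
    refine Real.sqrt_le_sqrt ?_
    rw [e1, e2, aux_minner_add, aux_minner_add]
    nlinarith [mul_le_mul_of_nonneg_left h1 (sq_nonneg (2 * mu))]
  · rintro p ⟨hp, hmin⟩
    have hptr := aux_N_trace hhydro hη hp
    have hH : hooke lam mu p = (2 * mu) • p := by simp [hooke, hptr]
    refine ⟨⟨hH ▸ aux_N_smul hp ha, fun w hw => ?_⟩, hH⟩
    have hm := aux_N_smul hw (inv_pos.2 ha)
    have hmtr := aux_N_trace hhydro hη hm
    have h1 := aux_le (hτ.sub hm.1) (hmin _ hm)
    have e1 : hooke lam mu τ - hooke lam mu p =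
        (2 * mu) • (τ - p) + (lam * τ.trace) • (1 : Mat3) := by
      rw [hH]; simp only [hooke]; module
    have e2 : hooke lam mu τ - w =
        (2 * mu) • (τ - (2 * mu)⁻¹ • w) + (lam * τ.trace) • (1 : Mat3) := by
      simp only [hooke]
      match_scalars <;> field_simp
    refine Real.sqrt_le_sqrt ?_
    rw [e1, e2, aux_minner_add, aux_minner_add, Matrix.trace_sub, Matrix.trace_sub, hptr, hmtr]
    nlinarith [mul_le_mul_of_nonneg_left h1 (sq_nonneg (2 * mu))]
end

section
/- Let C ⊆ M³ˣ³_sym be a nonempty closed convex set insensitive to hydrostatic pressure and σ ∈ C. Then for every τ ∈ M³ˣ³_sym, every α > 0 and every β ∈ ℝ: P_{N_C(σ)}(ατ + βI) = α · P_{N_C(σ)}(τ). -/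
open Matrix

/-- Elements of the normal cone are trace free. -/
lemma trace_normalCone (C : Set Mat3)
    (hhydro : ∀ A ∈ C, ∀ p : ℝ, A + p • (1 : Mat3) ∈ C)
    (σ : Mat3) (hσ : σ ∈ C) (n : Mat3) (hn : n ∈ normalCone C σ) : n.trace = 0 := by
  have key : ∀ q : ℝ, minner n (q • (1 : Mat3)) ≤ 0 := by
    intro q
    apply hn.2
    apply subset_closure
    exact ⟨σ + q • (1 : Mat3), hhydro σ hσ q, 1, one_pos, by simp⟩
  have h1 := key 1
  have h2 := key (-1)
  simp [minner] at h1 h2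
  linarith

lemma minner_self_nonneg (A : Mat3) (hA : A.IsSymm) : 0 ≤ minner A A := by
  have h : minner A A = ∑ i, ∑ j, A i j * A i j := by
    simp only [minner, Matrix.trace, Matrix.diag, Matrix.mul_apply]
    refine Finset.sum_congr rfl fun i _ => Finset.sum_congr rfl fun j _ => ?_
    rw [hA.apply i j]
  rw [h]
  exact Finset.sum_nonneg fun i _ => Finset.sum_nonneg fun j _ => mul_self_nonneg _

lemma minner_expand (τ w : Mat3) (hw : w.trace = 0) (α β : ℝ) :
    minner (α • τ + β • (1 : Mat3) - α • w) (α • τ + β • (1 : Mat3) - α • w)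
      = α ^ 2 * minner (τ - w) (τ - w) + (2 * α * β * τ.trace + 3 * β ^ 2) := by
  have e : α • τ + β • (1 : Mat3) - α • w = α • (τ - w) + β • (1 : Mat3) := by
    rw [smul_sub]; abel
  rw [e]
  generalize hd : τ - w = d
  have ht : τ.trace = d.trace := by rw [← hd, Matrix.trace_sub, hw, sub_zero]
  rw [ht]
  simp [minner, add_mul, mul_add, Matrix.trace_add, Matrix.trace_smul]
  ring

lemma smul_normalCone (C : Set Mat3) (σ n : Mat3) (hn : n ∈ normalCone C σ) (a : ℝ)
    (ha : 0 ≤ a) : a • n ∈ normalCone C σ := by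
  refine ⟨hn.1.smul a, fun t ht => ?_⟩
  have h := hn.2 t ht
  simp only [minner, Matrix.smul_mul, Matrix.trace_smul, smul_eq_mul] at h ⊢
  exact mul_nonpos_of_nonneg_of_nonpos ha h

/-- For a yield domain insensitive to hydrostatic pressure,
`P_{N_C(σ)}(ατ + βI) = α P_{N_C(σ)}(τ)` for all `α > 0` and `β ∈ ℝ`. -/
theorem stmt6 (C : Set Mat3)
    (hCsym : ∀ A ∈ C, A.IsSymm) (hne : C.Nonempty) (hcl : IsClosed C) (hconv : Convex ℝ C)
    (hhydro : ∀ A ∈ C, ∀ p : ℝ, A + p • (1 : Mat3) ∈ C)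
    (σ : Mat3) (hσ : σ ∈ C) :
    ∀ τ : Mat3, τ.IsSymm → ∀ α : ℝ, 0 < α → ∀ β : ℝ,
      ∀ p : Mat3, IsProjOn (normalCone C σ) τ p →
        IsProjOn (normalCone C σ) (α • τ + β • (1 : Mat3)) (α • p) := by
  intro τ hτ α hα β p hp
  refine ⟨smul_normalCone C σ p hp.1 α hα.le, fun w hw => ?_⟩
  have hv := smul_normalCone C σ w hw α⁻¹ (inv_nonneg.2 hα.le)
  obtain ⟨v, hvd⟩ : ∃ v, v = α⁻¹ • w := ⟨_, rfl⟩
  rw [← hvd] at hv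
  have hwv : w = α • v := by rw [hvd, smul_smul, mul_inv_cancel₀ hα.ne', one_smul]
  have h := hp.2 v hv
  unfold mnorm at h
  rw [Real.sqrt_le_sqrt_iff (minner_self_nonneg _ (hτ.sub hv.1))] at h
  rw [hwv]
  unfold mnorm
  apply Real.sqrt_le_sqrt
  rw [minner_expand τ p (trace_normalCone C hhydro σ hσ p hp.1),
    minner_expand τ v (trace_normalCone C hhydro σ hσ v hv)]
  have := mul_le_mul_of_nonneg_left h (sq_nonneg α)
  linarith
end

section
/- Let E be a real Hilbert space, T ⊆ E a nonempty closed convex cone with polar cone N = {n ∈ E : ⟪n, w⟫ ≤ 0 for all w ∈ T}, and let V ⊆ E be a closed linear subspace with N ⊆ V. Then for every τ ∈ E: P_N(τ) = P_N(P_V(τ)) and P_T(τ) = τ − P_N(P_V(τ)), where P_V is the orthogonal projection onto V. -/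
open RealInnerProductSpace

/-- `p` is the metric (orthogonal) projection of `z` onto `K`. -/
def IsMetricProj {E : Type*} [NormedAddCommGroup E] (K : Set E) (z p : E) : Prop :=
  p ∈ K ∧ ∀ w ∈ K, ‖z - p‖ ≤ ‖z - w‖

theorem IsMetricProj.inner_le {E : Type*} [NormedAddCommGroup E] [InnerProductSpace ℝ E]
    {K : Set E} (hK : Convex ℝ K) {z p : E} (h : IsMetricProj K z p) :
    ∀ w ∈ K, ⟪z - p, w - p⟫ ≤ 0 := by
  refine (norm_eq_iInf_iff_real_inner_le_zero hK h.1).1 ?_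
  haveI : Nonempty K := ⟨⟨p, h.1⟩⟩
  apply le_antisymm
  · exact le_ciInf fun w => h.2 w w.2
  · exact ciInf_le (f := fun w : K => ‖z - w‖)
      ⟨0, by rintro _ ⟨w, rfl⟩; exact norm_nonneg _⟩ ⟨p, h.1⟩

/-- If `T` is a nonempty closed convex cone with polar cone `N`, and `V` is a closed
subspace containing `N`, then `P_N = P_N ∘ P_V` and `P_T = Id - P_N ∘ P_V`. -/
theorem stmt7 {E : Type*} [NormedAddCommGroup E] [InnerProductSpace ℝ E] [CompleteSpace E]
    (T : Set E) (hne : T.Nonempty) (hcl : IsClosed T) (hconv : Convex ℝ T)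
    (hcone : ∀ c : ℝ, 0 < c → ∀ x ∈ T, c • x ∈ T)
    (N : Set E) (hN : N = {n | ∀ w ∈ T, ⟪n, w⟫ ≤ 0})
    (V : Submodule ℝ E) (hV : IsClosed (V : Set E)) (hNV : N ⊆ (V : Set E))
    (τ pV pN : E)
    (hpV : IsMetricProj (V : Set E) τ pV)
    (hpN : IsMetricProj N pV pN) :
    IsMetricProj N τ pN ∧ IsMetricProj T τ (τ - pN) := by
  -- pythagoras for V
  have horth : ∀ v ∈ V, ⟪τ - pV, v⟫ = 0 := by
    have h := hpV.inner_le V.convex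
    intro v hv
    have h1 := h (pV + v) (V.add_mem hpV.1 hv)
    have h2 := h (pV - v) (V.sub_mem hpV.1 hv)
    rw [add_sub_cancel_left] at h1
    rw [sub_sub_cancel_left, inner_neg_right] at h2
    linarith
  have hpyth : ∀ m ∈ N, ‖τ - m‖ ^ 2 = ‖τ - pV‖ ^ 2 + ‖pV - m‖ ^ 2 := by
    intro m hm
    have h := horth (pV - m) (V.sub_mem hpV.1 (hNV hm))
    have e : τ - m = (τ - pV) + (pV - m) := by abel
    rw [e, norm_add_sq_real, h]
    ring
  have hA : IsMetricProj N τ pN := by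
    refine ⟨hpN.1, fun w hw => ?_⟩
    have h1 := hpyth pN hpN.1
    have h2 := hpyth w hw
    have h3 := pow_le_pow_left₀ (norm_nonneg _) (hpN.2 w hw) 2
    exact (sq_le_sq₀ (norm_nonneg _) (norm_nonneg _)).1 (by linarith)
  refine ⟨hA, ?_⟩
  -- projection onto T
  obtain ⟨q, hqT, hq⟩ := exists_norm_eq_iInf_of_complete_convex hne hcl.isComplete hconv τ
  have hqm : IsMetricProj T τ q := by
    refine ⟨hqT, fun w hw => ?_⟩
    rw [hq]
    exact ciInf_le (f := fun w : T => ‖τ - w‖)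
      ⟨0, by rintro _ ⟨w, rfl⟩; exact norm_nonneg _⟩ ⟨w, hw⟩
  have hvi := hqm.inner_le hconv
  have hq0 : ⟪τ - q, q⟫ = 0 := by
    have h1 := hvi _ (hcone 2 (by norm_num) q hqT)
    have h2 := hvi _ (hcone (1/2) (by norm_num) q hqT)
    rw [inner_sub_right, inner_smul_right] at h1 h2
    linarith
  have hn : τ - q ∈ N := by
    rw [hN]
    intro w hw
    have h := hvi w hw
    rw [inner_sub_right, hq0] at h
    linarith
  have hpq : ⟪pN, q⟫ ≤ 0 := by
    have h := hpN.1
    rw [hN] at h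
    exact h q hqT
  have hle := pow_le_pow_left₀ (norm_nonneg _) (hA.2 _ hn) 2
  have e1 : τ - pN = q + (τ - q - pN) := by abel
  have e2 : τ - (τ - q) = q := by abel
  have hz : ‖τ - q - pN‖ ^ 2 ≤ 0 := by
    rw [e1, e2, norm_add_sq_real, inner_sub_right, real_inner_comm, hq0,
      real_inner_comm] at hle
    linarith
  have hz' : τ - q - pN = 0 := by
    rw [← norm_eq_zero]
    exact pow_eq_zero_iff (two_ne_zero) |>.1 (le_antisymm hz (sq_nonneg _))
  rw [e1, hz', add_zero]
  exact hqm
end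

section
/- Let E be a real Hilbert space and τ₁, τ₂ ∈ E unit vectors with δ := ⟪τ₁, τ₂⟫ satisfying δ² < 1. Let N = {η₁τ₁ + η₂τ₂ : η₁ ≥ 0, η₂ ≥ 0}. For τ ∈ E set a₁ = ⟪τ, τ₁⟫, a₂ = ⟪τ, τ₂⟫, α₁ = (a₁ − δa₂)/(1 − δ²), α₂ = (a₂ − δa₁)/(1 − δ²). Then: if α₁ ≥ 0 and α₂ ≥ 0, P_N(τ) = α₁τ₁ + α₂τ₂; if min(α₁, α₂) < 0 and a₁ ≥ a₂, P_N(τ) = max(a₁, 0)·τ₁; if min(α₁, α₂) < 0 and a₁ ≤ a₂, P_N(τ) = max(a₂, 0)·τ₂. -/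
open RealInnerProductSpace

theorem proj_aux {E : Type*} [NormedAddCommGroup E] [InnerProductSpace ℝ E]
    (τ₁ τ₂ : E) (hτ₁ : ‖τ₁‖ = 1) (hτ₂ : ‖τ₂‖ = 1)
    (δ : ℝ) (hδ : δ = ⟪τ₁, τ₂⟫) (hδ2 : δ ^ 2 < 1)
    (N : Set E) (hN : N = {x | ∃ η₁ η₂ : ℝ, 0 ≤ η₁ ∧ 0 ≤ η₂ ∧ x = η₁ • τ₁ + η₂ • τ₂})
    (τ : E) (a₁ a₂ : ℝ) (ha₁ : a₁ = ⟪τ, τ₁⟫) (ha₂ : a₂ = ⟪τ, τ₂⟫)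
    (b c : ℝ) (hb : 0 ≤ b) (hc : 0 ≤ c)
    (h1 : a₁ - b - δ * c ≤ 0) (h2 : a₂ - δ * b - c ≤ 0)
    (h3 : b * (a₁ - b - δ * c) = 0) (h4 : c * (a₂ - δ * b - c) = 0) :
    IsMetricProj N τ (b • τ₁ + c • τ₂) := by
  have key : ∀ x y : ℝ, ‖τ - (x • τ₁ + y • τ₂)‖ ^ 2 =
      ‖τ‖ ^ 2 - 2 * x * a₁ - 2 * y * a₂ + x ^ 2 + y ^ 2 + 2 * x * y * δ := by
    intro x y
    rw [norm_sub_sq_real, norm_add_sq_real, norm_smul, norm_smul, hτ₁, hτ₂,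
      inner_add_right, inner_smul_right, inner_smul_right, real_inner_smul_left,
      inner_smul_right, ← ha₁, ← ha₂, ← hδ]
    simp only [mul_one, Real.norm_eq_abs, sq_abs]
    ring
  subst hN
  refine ⟨⟨b, c, hb, hc, rfl⟩, ?_⟩
  rintro w ⟨x, y, hx, hy, rfl⟩
  refine (sq_le_sq₀ (norm_nonneg _) (norm_nonneg _)).1 ?_
  rw [key, key]
  have e1 := mul_nonneg hx (sub_nonneg.2 h1)
  have e2 := mul_nonneg hy (sub_nonneg.2 h2)
  have e3 := sq_nonneg ((x - b) + δ * (y - c))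
  have e4 := mul_nonneg (sub_nonneg.2 hδ2.le) (sq_nonneg (y - c))
  nlinarith

/-- Projection onto the cone generated by two independent unit vectors `τ₁, τ₂`. -/
theorem stmt9 {E : Type*} [NormedAddCommGroup E] [InnerProductSpace ℝ E] [CompleteSpace E]
    (τ₁ τ₂ : E) (hτ₁ : ‖τ₁‖ = 1) (hτ₂ : ‖τ₂‖ = 1)
    (δ : ℝ) (hδ : δ = ⟪τ₁, τ₂⟫) (hδ2 : δ ^ 2 < 1)
    (N : Set E) (hN : N = {x | ∃ η₁ η₂ : ℝ, 0 ≤ η₁ ∧ 0 ≤ η₂ ∧ x = η₁ • τ₁ + η₂ • τ₂})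
    (τ : E) (a₁ a₂ α₁ α₂ : ℝ)
    (ha₁ : a₁ = ⟪τ, τ₁⟫) (ha₂ : a₂ = ⟪τ, τ₂⟫)
    (hα₁ : α₁ = (a₁ - δ * a₂) / (1 - δ ^ 2))
    (hα₂ : α₂ = (a₂ - δ * a₁) / (1 - δ ^ 2)) :
    (0 ≤ α₁ → 0 ≤ α₂ → IsMetricProj N τ (α₁ • τ₁ + α₂ • τ₂)) ∧
    (min α₁ α₂ < 0 → a₂ ≤ a₁ → IsMetricProj N τ (max a₁ 0 • τ₁)) ∧
    (min α₁ α₂ < 0 → a₁ ≤ a₂ → IsMetricProj N τ (max a₂ 0 • τ₂)) := by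
  have hd : 0 < 1 - δ ^ 2 := by linarith
  have hd1 : 0 < 1 - δ := by nlinarith
  have hd2 : 0 < 1 + δ := by nlinarith
  have e1 : α₁ * (1 - δ ^ 2) = a₁ - δ * a₂ := by rw [hα₁]; field_simp
  have e2 : α₂ * (1 - δ ^ 2) = a₂ - δ * a₁ := by rw [hα₂]; field_simp
  have f1 : a₁ - α₁ - δ * α₂ = 0 := by
    have : (a₁ - α₁ - δ * α₂) * (1 - δ ^ 2) = 0 := by linear_combination -e1 - δ * e2
    exact (mul_eq_zero.1 this).resolve_right hd.ne'
  have f2 : a₂ - δ * α₁ - α₂ = 0 := by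
    have : (a₂ - δ * α₁ - α₂) * (1 - δ ^ 2) = 0 := by linear_combination -e2 - δ * e1
    exact (mul_eq_zero.1 this).resolve_right hd.ne'
  have g : (α₁ - α₂) * (1 - δ) = a₁ - a₂ := by linear_combination f2 - f1
  have P := proj_aux τ₁ τ₂ hτ₁ hτ₂ δ hδ hδ2 N hN τ a₁ a₂ ha₁ ha₂
  refine ⟨fun h1 h2 => P _ _ h1 h2 f1.le f2.le (by rw [f1, mul_zero]) (by rw [f2, mul_zero]),
    fun hm h => ?_, fun hm h => ?_⟩
  · have hle : α₂ ≤ α₁ := by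
      by_contra hc
      push Not at hc
      nlinarith [mul_pos (sub_pos.2 hc) hd1]
    rw [min_eq_right hle] at hm
    have hs : a₂ - δ * a₁ < 0 := by rw [← e2]; exact mul_neg_of_neg_of_pos hm hd
    have Q := P (max a₁ 0) 0 (le_max_right _ _) le_rfl
    rw [zero_smul, add_zero] at Q
    rcases le_total a₁ 0 with h0 | h0
    · rw [max_eq_right h0] at Q ⊢
      exact Q (by linarith) (by linarith) (by ring) (by ring)
    · rw [max_eq_left h0] at Q ⊢
      exact Q (by linarith) (by linarith) (by ring) (by ring)
  · have hle : α₁ ≤ α₂ := by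
      by_contra hc
      push Not at hc
      nlinarith [mul_pos (sub_pos.2 hc) hd1]
    rw [min_eq_left hle] at hm
    have hs : a₁ - δ * a₂ < 0 := by rw [← e1]; exact mul_neg_of_neg_of_pos hm hd
    have Q := P 0 (max a₂ 0) le_rfl (le_max_right _ _)
    rw [zero_smul, zero_add] at Q
    rcases le_total a₂ 0 with h0 | h0
    · rw [max_eq_right h0] at Q ⊢
      exact Q (by linarith) (by linarith) (by ring) (by ring)
    · rw [max_eq_left h0] at Q ⊢
      exact Q (by linarith) (by linarith) (by ring) (by ring)
end

section
/- Let C ⊆ M³ˣ³_sym be a nonempty closed convex set insensitive to hydrostatic pressure, σ ∈ C, and g ∈ M³ˣ³_sym with g ≠ 0 such that T_C(σ) = {φ ∈ M³ˣ³_sym : φ:g ≤ 0}. Let λ > 0, μ > 0 and H(τ) = 2μτ + λ tr(τ)I. Then tr(g) = 0 and for every ε̇ ∈ M³ˣ³_sym: P_{N_C(σ)}(ε̇) = (max(0, ε̇:g)/‖g‖²)·g, P_{T_C(σ)}(ε̇) = ε̇ − (max(0, ε̇:g)/‖g‖²)·g, and P_{T_C(σ)}(H(ε̇)) = λ tr(ε̇)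 I + 2μ(ε̇ − (max(0, ε̇:g)/‖g‖²)·g). -/
open Matrix

theorem mi_comm (A B : Mat3) : minner A B = minner B A := by
  unfold minner; exact Matrix.trace_mul_comm A B

theorem mi_sub (A B D : Mat3) : minner (A - B) D = minner A D - minner B D := by
  unfold minner; rw [Matrix.sub_mul, Matrix.trace_sub]

theorem mi_add (A B D : Mat3) : minner (A + B) D = minner A D + minner B D := by
  unfold minner; rw [Matrix.add_mul, Matrix.trace_add]

theorem mi_smul (c : ℝ) (A D : Mat3) : minner (c • A) D = c * minner A D := by
  unfold minner; rw [Matrix.smul_mul, Matrix.trace_smul, smul_eq_mul]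

theorem mi_sub' (A B D : Mat3) : minner D (A - B) = minner D A - minner D B := by
  rw [mi_comm, mi_sub, mi_comm A, mi_comm B]

theorem mi_one (D : Mat3) : minner 1 D = D.trace := by
  unfold minner; rw [Matrix.one_mul]

theorem mi_sum (A : Mat3) (h : A.IsSymm) : minner A A = ∑ i, ∑ j, A i j ^ 2 := by
  unfold minner
  simp only [Matrix.trace, Matrix.diag, Matrix.mul_apply]
  refine Finset.sum_congr rfl fun i _ => Finset.sum_congr rfl fun j _ => ?_
  rw [h.apply i j]; ring

theorem mi_nonneg (A : Mat3) (h : A.IsSymm) : 0 ≤ minner A A := by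
  rw [mi_sum A h]; positivity

theorem mi_pos (A : Mat3) (h : A.IsSymm) (h0 : A ≠ 0) : 0 < minner A A := by
  refine lt_of_le_of_ne (mi_nonneg A h) fun he => h0 ?_
  rw [mi_sum A h] at he
  ext i j
  have h1 := (Finset.sum_eq_zero_iff_of_nonneg (fun i _ => by positivity)).1 he.symm i
    (Finset.mem_univ i)
  have h2 := (Finset.sum_eq_zero_iff_of_nonneg (fun i _ => by positivity)).1 h1 j
    (Finset.mem_univ j)
  simpa using h2

theorem proj_of (K : Set Mat3) (z p : Mat3) (hK : ∀ w ∈ K, w.IsSymm) (hp : p ∈ K)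
    (h : ∀ w ∈ K, minner (z - p) (w - p) ≤ 0) : IsProjOn K z p := by
  refine ⟨hp, fun w hw => Real.sqrt_le_sqrt ?_⟩
  have h1 := mi_nonneg (w - p) ((hK w hw).sub (hK p hp))
  have h2 := h w hw
  have e : z - w = (z - p) - (w - p) := by abel
  rw [e]
  generalize z - p = a at *
  generalize w - p = b at *
  rw [mi_sub, mi_sub', mi_sub', mi_comm b a]
  linarith

/-- Theorem 3.2 (one saturated yield function): if the tangent cone at `σ` is the
half-space `{φ : φ:g ≤ 0}` for some nonzero symmetric `g`, then `tr g = 0` and the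
projections onto the normal and tangent cones, and the stress rate, are given explicitly. -/
theorem stmt10 (C : Set Mat3)
    (hCsym : ∀ A ∈ C, A.IsSymm) (hne : C.Nonempty) (hcl : IsClosed C) (hconv : Convex ℝ C)
    (hhydro : ∀ A ∈ C, ∀ p : ℝ, A + p • (1 : Mat3) ∈ C)
    (σ : Mat3) (hσ : σ ∈ C)
    (g : Mat3) (hgsym : g.IsSymm) (hg : g ≠ 0)
    (htg : tangentCone C σ = {φ : Mat3 | φ.IsSymm ∧ minner φ g ≤ 0})
    (lam mu : ℝ) (hlam : 0 < lam) (hmu : 0 < mu) :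
    g.trace = 0 ∧
    ∀ ε' : Mat3, ε'.IsSymm →
      IsProjOn (normalCone C σ) ε' ((max 0 (minner ε' g) / mnorm g ^ 2) • g) ∧
      IsProjOn (tangentCone C σ) ε' (ε' - (max 0 (minner ε' g) / mnorm g ^ 2) • g) ∧
      IsProjOn (tangentCone C σ) (hooke lam mu ε')
        ((lam * ε'.trace) • (1 : Mat3) +
          (2 * mu) • (ε' - (max 0 (minner ε' g) / mnorm g ^ 2) • g)) := by
  have htr : ∀ p : ℝ, p * g.trace ≤ 0 := by
    intro p
    have : p • (1 : Mat3) ∈ tangentCone C σ :=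
      subset_closure ⟨σ + p • (1 : Mat3), hhydro σ hσ p, 1, one_pos, by simp⟩
    rw [htg] at this
    have h := this.2
    rwa [mi_smul, mi_one] at h
  have htr0 : g.trace = 0 := by
    have := htr 1
    have := htr (-1)
    linarith
  refine ⟨htr0, fun e he => ?_⟩
  have hG := mi_pos g hgsym hg
  have hn : mnorm g ^ 2 = minner g g := Real.sq_sqrt hG.le
  rw [hn]
  set c := max 0 (minner e g) / minner g g with hc
  have hc0 : 0 ≤ c := div_nonneg (le_max_left _ _) hG.le
  have hcG : c * minner g g = max 0 (minner e g) := div_mul_cancel₀ _ hG.ne'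
  have hle : minner e g - c * minner g g ≤ 0 := by
    rw [hcG]; linarith [le_max_right 0 (minner e g)]
  have hz : c * (minner e g - c * minner g g) = 0 := by
    rcases le_total (minner e g) 0 with h | h
    · have : c = 0 := by rw [hc, max_eq_left h, zero_div]
      rw [this, zero_mul]
    · rw [hcG, max_eq_right h, sub_self, mul_zero]
  have hqs : (e - c • g).IsSymm := he.sub (hgsym.smul c)
  have hqT : e - c • g ∈ tangentCone C σ := by
    rw [htg]; exact ⟨hqs, by rw [mi_sub, mi_smul]; exact hle⟩
  have hTs : ∀ w ∈ tangentCone C σ, w.IsSymm := fun w hw => by rw [htg] at hw; exact hw.1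
  have hTi : ∀ w ∈ tangentCone C σ, minner w g ≤ 0 := fun w hw => by rw [htg] at hw; exact hw.2
  refine ⟨proj_of _ _ _ (fun w hw => hw.1) ⟨hgsym.smul c, fun τ hτ => ?_⟩ fun w hw => ?_,
    proj_of _ _ _ hTs hqT fun w hw => ?_, proj_of _ _ _ hTs ?_ fun w hw => ?_⟩
  · rw [mi_smul, mi_comm]
    exact mul_nonpos_of_nonneg_of_nonpos hc0 (hTi τ hτ)
  · have h1 := hw.2 _ hqT
    rw [mi_sub', mi_comm _ w, mi_comm _ (c • g), mi_smul, mi_comm g, mi_sub, mi_smul, hz]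
    linarith
  · have h1 := mul_nonpos_of_nonneg_of_nonpos hc0 (hTi w hw)
    rw [sub_sub_cancel, mi_smul, mi_comm, mi_sub, mi_sub, mi_smul, mul_sub, hz]
    linarith
  · rw [htg]
    refine ⟨((Matrix.isSymm_one).smul _).add (hqs.smul _), ?_⟩
    rw [mi_add, mi_smul, mi_smul, mi_one, htr0, mi_sub, mi_smul]
    have := mul_nonpos_of_nonneg_of_nonpos (by positivity : 0 ≤ 2 * mu) hle
    linarith
  · have h1 := mul_nonpos_of_nonneg_of_nonpos hc0 (hTi w hw)
    have e1 : hooke lam mu e - ((lam * e.trace) • (1 : Mat3) + (2 * mu) • (e - c • g))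
        = (2 * mu) • (c • g) := by
      unfold hooke; rw [smul_sub]; abel
    rw [e1, mi_smul, mi_smul, mi_comm, mi_sub, mi_add, mi_smul, mi_smul, mi_one, htr0,
      mi_sub, mi_smul]
    refine mul_nonpos_of_nonneg_of_nonpos (by positivity) ?_
    linear_combination h1 - 2 * mu * hz
end

section
/- Let σ ∈ M³ˣ³_sym have three distinct eigenvalues λ₁(σ) > λ₂(σ) > λ₃(σ), and let v₁ and v₃ be unit eigenvectors of σ corresponding to λ₁(σ) and λ₃(σ) respectively. Then the Tresca function f_T(τ) = ½(λ₁(τ) − λ₃(τ)) is Fréchet differentiable at σ as a function on M³ˣ³_sym, its gradient with respect to the Frobenius inner product is ∇f_T(σ) = ½(v₁v₁ᵀ − v₃v₃ᵀ) (i.e. the derivative of f_T at σ in any direction τ ∈ M³ˣ³_sym equals ½(v₁·(τv₁) − v₃·(τv₃))), and ‖∇f_T(σ)‖² = 1/2. -/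
open Matrix

attribute [local instance] Matrix.frobeniusNormedAddCommGroup Matrix.frobeniusNormedSpace

/-- The set of (real) eigenvalues of `A`, i.e. the real roots of `det(A - t I) = 0`. -/
def eigSet (A : Mat3) : Set ℝ := {t : ℝ | (A - t • (1 : Mat3)).det = 0}

/-- The largest eigenvalue `λ₁(A)` of `A`. -/
noncomputable def lam1 (A : Mat3) : ℝ := sSup (eigSet A)

/-- The smallest eigenvalue `λ₃(A)` of `A`. -/
noncomputable def lam3 (A : Mat3) : ℝ := sInf (eigSet A)

/-- The middle eigenvalue `λ₂(A)` of `A` (recovered from the trace). -/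
noncomputable def lam2 (A : Mat3) : ℝ := A.trace - lam1 A - lam3 A

/-- The Tresca yield function `f_T(σ) = (λ₁(σ) - λ₃(σ))/2`. -/
noncomputable def fTresca (A : Mat3) : ℝ := (lam1 A - lam3 A) / 2

lemma eigSet_finite (A : Mat3) : (eigSet A).Finite := by
  refine (Polynomial.finite_setOfPred_isRoot (A.charpoly_monic.ne_zero)).subset ?_
  intro t ht
  have ht' : (A - t • (1 : Mat3)).det = 0 := ht
  show Polynomial.IsRoot _ _
  rw [Polynomial.IsRoot.def, Matrix.eval_charpoly]
  have : Matrix.scalar (Fin 3) t - A = -(A - t • (1 : Mat3)) := by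
    rw [neg_sub, Matrix.smul_one_eq_diagonal]
    rfl
  rw [this, Matrix.det_neg, ht', mul_zero]

lemma mem_eigSet_iff (A : Mat3) (t : ℝ) : t ∈ eigSet A ↔ ∃ v ≠ 0, A *ᵥ v = t • v := by
  show (A - t • (1 : Mat3)).det = 0 ↔ _
  rw [← Matrix.exists_mulVec_eq_zero_iff]
  simp only [Matrix.sub_mulVec, Matrix.smul_mulVec, Matrix.one_mulVec, sub_eq_zero]

lemma symm_herm {A : Mat3} (hA : A.IsSymm) : A.IsHermitian := by
  rw [Matrix.IsHermitian, Matrix.conjTranspose_eq_transpose_of_trivial]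
  exact hA

lemma herm_eig_mem {A : Mat3} (hA : A.IsHermitian) (i : Fin 3) : hA.eigenvalues i ∈ eigSet A := by
  rw [mem_eigSet_iff]
  refine ⟨_, ?_, hA.mulVec_eigenvectorBasis i⟩
  intro h
  apply hA.eigenvectorBasis.orthonormal.ne_zero i
  ext j
  exact congrFun h j

lemma lam1_mem {A : Mat3} (hA : A.IsSymm) : lam1 A ∈ eigSet A :=
  Set.Nonempty.csSup_mem ⟨_, herm_eig_mem (symm_herm hA) 0⟩ (eigSet_finite A)

lemma rayleigh_le {A : Mat3} (hA : A.IsSymm) (x : Fin 3 → ℝ) :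
    x ⬝ᵥ (A *ᵥ x) ≤ lam1 A * (x ⬝ᵥ x) := by
  have hB : (lam1 A • (1 : Mat3) - A).IsSymm := by
    rw [Matrix.IsSymm, Matrix.transpose_sub, Matrix.transpose_smul, Matrix.transpose_one, hA.eq]
  have hpos : (lam1 A • (1 : Mat3) - A).PosSemidef := by
    rw [(symm_herm hB).posSemidef_iff_eigenvalues_nonneg]
    intro i
    have h := herm_eig_mem (symm_herm hB) i
    set μ := (symm_herm hB).eigenvalues i
    rw [mem_eigSet_iff] at h
    obtain ⟨v, hv0, hv⟩ := h
    have hm : lam1 A - μ ∈ eigSet A := by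
      rw [mem_eigSet_iff]
      refine ⟨v, hv0, ?_⟩
      rw [Matrix.sub_mulVec, Matrix.smul_mulVec, Matrix.one_mulVec] at hv
      rw [sub_smul, ← hv, sub_sub_cancel]
    have := le_csSup (eigSet_finite A).bddAbove hm
    change lam1 A - μ ≤ lam1 A at this
    show 0 ≤ μ
    linarith
  have := hpos.dotProduct_mulVec_nonneg x
  rw [star_trivial, Matrix.sub_mulVec, Matrix.smul_mulVec, Matrix.one_mulVec, dotProduct_sub,
    dotProduct_smul, smul_eq_mul] at this
  linarith

lemma lam1_unit {A : Mat3} (hA : A.IsSymm) :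
    ∃ u : Fin 3 → ℝ, u ⬝ᵥ u = 1 ∧ u ⬝ᵥ (A *ᵥ u) = lam1 A := by
  obtain ⟨v, hv0, hv⟩ := (mem_eigSet_iff A _).1 (lam1_mem hA)
  have hp : 0 < v ⬝ᵥ v := by
    have h0 : 0 ≤ v ⬝ᵥ v := by
      simp only [dotProduct]
      exact Finset.sum_nonneg fun i _ => mul_self_nonneg _
    exact lt_of_le_of_ne h0 fun h => hv0 (dotProduct_self_eq_zero.1 h.symm)
  have hs : Real.sqrt (v ⬝ᵥ v) * Real.sqrt (v ⬝ᵥ v) = v ⬝ᵥ v := Real.mul_self_sqrt hp.le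
  have hs0 : Real.sqrt (v ⬝ᵥ v) ≠ 0 := (Real.sqrt_pos.2 hp).ne'
  have key : ((Real.sqrt (v ⬝ᵥ v))⁻¹ • v) ⬝ᵥ ((Real.sqrt (v ⬝ᵥ v))⁻¹ • v) = 1 := by
    rw [smul_dotProduct, dotProduct_smul, smul_eq_mul, smul_eq_mul]
    nth_rewrite 3 [← hs]
    field_simp
  refine ⟨(Real.sqrt (v ⬝ᵥ v))⁻¹ • v, key, ?_⟩
  rw [Matrix.mulVec_smul, hv, smul_comm, dotProduct_smul, key, smul_eq_mul, mul_one]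

lemma eigSet_neg (A : Mat3) : eigSet (-A) = -eigSet A := by
  ext t
  rw [Set.mem_neg, mem_eigSet_iff, mem_eigSet_iff]
  simp only [Matrix.neg_mulVec, neg_smul, neg_eq_iff_eq_neg]

lemma lam1_neg (A : Mat3) : lam1 (-A) = -lam3 A := by
  rw [lam1, lam3, eigSet_neg, Real.sInf_def, neg_neg]

lemma lam3_neg (A : Mat3) : lam3 (-A) = -lam1 A := by
  have := lam1_neg (-A)
  rw [neg_neg] at this
  linarith

lemma rayleigh_ge {A : Mat3} (hA : A.IsSymm) (x : Fin 3 → ℝ) :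
    lam3 A * (x ⬝ᵥ x) ≤ x ⬝ᵥ (A *ᵥ x) := by
  have := rayleigh_le (A := -A) hA.neg x
  rw [lam1_neg, Matrix.neg_mulVec, dotProduct_neg] at this
  linarith

lemma cross_identity (A : Mat3) (v w : Fin 3 → ℝ) :
    (crossProduct v w) ⬝ᵥ (A *ᵥ (crossProduct v w)) =
      ((v ⬝ᵥ v) * (w ⬝ᵥ w) - (v ⬝ᵥ w) ^ 2) * A.trace - (w ⬝ᵥ w) * (v ⬝ᵥ (A *ᵥ v))
      - (v ⬝ᵥ v) * (w ⬝ᵥ (A *ᵥ w)) + (v ⬝ᵥ w) * (v ⬝ᵥ (A *ᵥ w) + w ⬝ᵥ (A *ᵥ v)) := by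
  simp [crossProduct, dotProduct, Matrix.mulVec, Fin.sum_univ_three, Matrix.trace]
  ring

lemma gap_le {A : Mat3} (hA : A.IsSymm) {v w : Fin 3 → ℝ} (hv : A *ᵥ v = lam1 A • v)
    (hu : v ⬝ᵥ v = 1) (hvw : v ⬝ᵥ w = 0) : w ⬝ᵥ (A *ᵥ w) ≤ lam2 A * (w ⬝ᵥ w) := by
  have h1 := cross_identity A v w
  have h2 := rayleigh_ge hA (crossProduct v w)
  have h3 : (crossProduct v w) ⬝ᵥ (crossProduct v w) = w ⬝ᵥ w := by
    rw [cross_dot_cross, hu, hvw]; ring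
  rw [h3] at h2
  rw [hvw, hv, dotProduct_smul, hu, smul_eq_mul] at h1
  rw [lam2]
  nlinarith

lemma entry_le (A : Mat3) (i j : Fin 3) : |A i j| ≤ ‖A‖ := by
  have h : ‖A‖ = Real.sqrt (∑ i, ∑ j, (A i j) ^ 2) := by
    rw [Matrix.frobenius_norm_def, Real.sqrt_eq_rpow]
    simp
  rw [h]
  apply Real.abs_le_sqrt
  calc (A i j) ^ 2 ≤ ∑ j, (A i j) ^ 2 :=
        Finset.single_le_sum (f := fun j => (A i j) ^ 2) (fun _ _ => sq_nonneg _) (Finset.mem_univ j)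
    _ ≤ _ := Finset.single_le_sum (f := fun i => ∑ j, (A i j) ^ 2)
        (fun _ _ => Finset.sum_nonneg fun _ _ => sq_nonneg _) (Finset.mem_univ i)

lemma coord_le (x : Fin 3 → ℝ) (r : ℝ) (hr : 0 ≤ r) (hx : x ⬝ᵥ x = r ^ 2) (i : Fin 3) :
    |x i| ≤ r := by
  refine abs_le_of_sq_le_sq ?_ hr
  rw [← hx, pow_two]
  exact Finset.single_le_sum (f := fun i => x i * x i) (fun _ _ => mul_self_nonneg _)
    (Finset.mem_univ i)

lemma bilin_le (A : Mat3) (x y : Fin 3 → ℝ) (r s : ℝ) (hr : 0 ≤ r) (hs : 0 ≤ s)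
    (hx : x ⬝ᵥ x = r ^ 2) (hy : y ⬝ᵥ y = s ^ 2) : |x ⬝ᵥ (A *ᵥ y)| ≤ 9 * ‖A‖ * r * s := by
  have h : x ⬝ᵥ (A *ᵥ y) = ∑ i, ∑ j, x i * (A i j * y j) := by
    simp only [dotProduct, Matrix.mulVec, Finset.mul_sum]
  rw [h]
  calc |∑ i, ∑ j, x i * (A i j * y j)| ≤ ∑ i, |∑ j, x i * (A i j * y j)| :=
        Finset.abs_sum_le_sum_abs _ _
    _ ≤ ∑ i, ∑ j, |x i * (A i j * y j)| :=
        Finset.sum_le_sum fun i _ => Finset.abs_sum_le_sum_abs _ _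
    _ ≤ ∑ _i : Fin 3, ∑ _j : Fin 3, r * (‖A‖ * s) := by
        refine Finset.sum_le_sum fun i _ => Finset.sum_le_sum fun j _ => ?_
        rw [abs_mul, abs_mul]
        have := coord_le x r hr hx i
        have := coord_le y s hs hy j
        have := entry_le A i j
        gcongr
    _ = _ := by simp; ring

lemma symm_swap {A : Mat3} (hA : A.IsSymm) (x y : Fin 3 → ℝ) :
    x ⬝ᵥ (A *ᵥ y) = y ⬝ᵥ (A *ᵥ x) := by
  rw [Matrix.dotProduct_mulVec, ← Matrix.mulVec_transpose, hA.eq, dotProduct_comm]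

lemma lam1_est {σ : Mat3} (hσ : σ.IsSymm) (h12 : lam2 σ < lam1 σ) {v : Fin 3 → ℝ}
    (hv : σ *ᵥ v = lam1 σ • v) (hu : v ⬝ᵥ v = 1) {τ : Mat3} (hτ : τ.IsSymm) :
    |lam1 (σ + τ) - lam1 σ - v ⬝ᵥ (τ *ᵥ v)| ≤ 324 / (lam1 σ - lam2 σ) * ‖τ‖ ^ 2 := by
  have hg : 0 < lam1 σ - lam2 σ := sub_pos.2 h12
  have hlow : lam1 σ + v ⬝ᵥ (τ *ᵥ v) ≤ lam1 (σ + τ) := by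
    have := rayleigh_le (hσ.add hτ) v
    rw [Matrix.add_mulVec, dotProduct_add, hv, dotProduct_smul, hu, smul_eq_mul] at this
    linarith
  rw [abs_of_nonneg (by linarith)]
  obtain ⟨u, huu, hul⟩ := lam1_unit (hσ.add hτ)
  obtain ⟨a, w, hvw, rfl⟩ : ∃ (a : ℝ) (w : Fin 3 → ℝ), v ⬝ᵥ w = 0 ∧ u = a • v + w := by
    refine ⟨v ⬝ᵥ u, u - (v ⬝ᵥ u) • v, ?_, by abel⟩
    rw [dotProduct_sub, dotProduct_smul, hu, smul_eq_mul]; ring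
  have hwv : w ⬝ᵥ v = 0 := by rw [dotProduct_comm, hvw]
  have hw0 : 0 ≤ w ⬝ᵥ w := Finset.sum_nonneg fun i _ => mul_self_nonneg _
  set r := Real.sqrt (w ⬝ᵥ w) with hr
  have hr0 : 0 ≤ r := Real.sqrt_nonneg _
  have hrr : w ⬝ᵥ w = r ^ 2 := (Real.sq_sqrt hw0).symm
  have hgap := gap_le hσ hv hu hvw
  have hvw1 := bilin_le τ v w 1 r zero_le_one hr0 (by rw [hu]; norm_num) hrr
  have hww1 := bilin_le τ w w r r hr0 hr0 hrr hrr
  have hvv1 := bilin_le τ v v 1 1 zero_le_one zero_le_one (by rw [hu]; norm_num)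
    (by rw [hu]; norm_num)
  have hsw := symm_swap hτ w v
  have hsw' := symm_swap hσ v w
  simp only [Matrix.add_mulVec, Matrix.mulVec_add, Matrix.mulVec_smul, dotProduct_add,
    add_dotProduct, dotProduct_smul, smul_dotProduct, smul_eq_mul, hu, hvw, hwv, hsw, hsw', hv,
    hrr] at huu hul hgap
  clear_value r
  set N := ‖τ‖
  have hN : 0 ≤ N := norm_nonneg _
  set p := v ⬝ᵥ (τ *ᵥ v)
  set q := v ⬝ᵥ (τ *ᵥ w)
  set m := w ⬝ᵥ (τ *ᵥ w)
  set k := w ⬝ᵥ (σ *ᵥ w)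
  have ha2 : a ^ 2 = 1 - r ^ 2 := by linarith
  have hr1 : r ≤ 1 := by nlinarith [sq_nonneg a]
  have ha1 : |a| ≤ 1 := abs_le_one_iff_mul_self_le_one.2 (by nlinarith)
  have haq : a * q ≤ 9 * N * r := by
    calc a * q ≤ |a * q| := le_abs_self _
      _ = |a| * |q| := abs_mul _ _
      _ ≤ 1 * |q| := by gcongr
      _ ≤ _ := by linarith
  have hNr : N * r ^ 2 ≤ N * r := by
    have : r ^ 2 ≤ r := by nlinarith
    gcongr
  have hp := (abs_le.1 hvv1).1
  have hm := (abs_le.1 hww1).2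
  have hpr : -(p * r ^ 2) ≤ 9 * N * r ^ 2 := by nlinarith [sq_nonneg r]
  have hmain : lam1 (σ + τ) - lam1 σ - p ≤ 36 * (N * r) - (lam1 σ - lam2 σ) * r ^ 2 := by
    have e : lam1 (σ + τ) = a ^ 2 * lam1 σ + k + (a ^ 2 * p + 2 * (a * q) + m) := by
      rw [← hul]; ring
    rw [e, ha2]
    nlinarith
  refine hmain.trans ?_
  rw [div_mul_eq_mul_div, le_div_iff₀ hg]
  nlinarith [sq_nonneg (18 * N - (lam1 σ - lam2 σ) * r)]

/-- The linear functional `τ ↦ v·τv`. -/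
noncomputable def quadL (v : Fin 3 → ℝ) : Mat3 →L[ℝ] ℝ :=
  LinearMap.toContinuousLinearMap
    { toFun := fun τ => v ⬝ᵥ (τ *ᵥ v)
      map_add' := fun x y => by rw [Matrix.add_mulVec, dotProduct_add]
      map_smul' := fun c x => by
        rw [Matrix.smul_mulVec, dotProduct_smul, RingHom.id_apply] }

lemma quadL_apply (v : Fin 3 → ℝ) (τ : Mat3) : quadL v τ = v ⬝ᵥ (τ *ᵥ v) := rfl

lemma lam1_deriv {σ : Mat3} (hσ : σ.IsSymm) (h12 : lam2 σ < lam1 σ) {v : Fin 3 → ℝ}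
    (hv : σ *ᵥ v = lam1 σ • v) (hu : v ⬝ᵥ v = 1) :
    HasFDerivWithinAt lam1 (quadL v) {A : Mat3 | A.IsSymm} σ := by
  refine hasFDerivWithinAt_iff_isLittleO.2 ?_
  have hO : (fun x : Mat3 => lam1 x - lam1 σ - quadL v (x - σ))
      =O[nhdsWithin σ {A : Mat3 | A.IsSymm}] fun x => ‖x - σ‖ ^ 2 := by
    refine Asymptotics.IsBigO.of_bound (324 / (lam1 σ - lam2 σ)) ?_
    filter_upwards [self_mem_nhdsWithin] with x hx
    have hx' : x.IsSymm := hx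
    have := lam1_est hσ h12 hv hu (hx'.sub hσ)
    rw [add_sub_cancel] at this
    rw [quadL_apply, Real.norm_eq_abs, norm_pow, norm_norm]
    exact this
  refine hO.trans_isLittleO ?_
  exact (Asymptotics.isLittleO_pow_sub_sub σ (by norm_num : 1 < 2)).mono nhdsWithin_le_nhds

lemma lam3_deriv {σ : Mat3} (hσ : σ.IsSymm) (h23 : lam3 σ < lam2 σ) {v : Fin 3 → ℝ}
    (hv : σ *ᵥ v = lam3 σ • v) (hu : v ⬝ᵥ v = 1) :
    HasFDerivWithinAt lam3 (quadL v) {A : Mat3 | A.IsSymm} σ := by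
  have hl2 : lam2 (-σ) = -lam2 σ := by
    rw [lam2, lam2, lam1_neg, lam3_neg, Matrix.trace_neg]; ring
  have h := lam1_deriv (σ := -σ) hσ.neg (by rw [hl2, lam1_neg]; linarith) (v := v)
    (by rw [Matrix.neg_mulVec, hv, lam1_neg, neg_smul]) hu
  have hn : HasFDerivWithinAt (fun A : Mat3 => -A) (-ContinuousLinearMap.id ℝ Mat3)
      {A : Mat3 | A.IsSymm} σ := (hasFDerivWithinAt_id _ _).neg
  have hc := (h.comp σ hn (fun A (hA : A.IsSymm) => hA.neg)).neg
  have e1 : lam3 = -(lam1 ∘ fun A : Mat3 => -A) := by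
    funext A
    simp [lam1_neg]
  have e2 : quadL v = -((quadL v).comp (-ContinuousLinearMap.id ℝ Mat3)) := by
    ext A
    simp
  rw [e1, e2]
  exact hc

lemma grad_norm {v w : Fin 3 → ℝ} (hv : v ⬝ᵥ v = 1) (hw : w ⬝ᵥ w = 1) (hvw : v ⬝ᵥ w = 0) :
    minner ((1 / 2 : ℝ) • (vecMulVec v v - vecMulVec w w))
        ((1 / 2 : ℝ) • (vecMulVec v v - vecMulVec w w)) = 1 / 2 := by
  have hwv : w ⬝ᵥ v = 0 := by rw [dotProduct_comm, hvw]
  simp [minner, sub_mul, mul_sub, Matrix.vecMulVec_mul_vecMulVec, hv, hw, hvw, hwv,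
    Matrix.trace_vecMulVec]
  norm_num

/-- At a symmetric matrix `σ` with three distinct eigenvalues, the Tresca function is
(Fréchet) differentiable on `M³ˣ³_sym` with gradient `½(v₁v₁ᵀ - v₃v₃ᵀ)`, whose squared
Frobenius norm is `1/2`. -/
theorem stmt14 (σ : Mat3) (hσ : σ.IsSymm)
    (h12 : lam2 σ < lam1 σ) (h23 : lam3 σ < lam2 σ)
    (v₁ v₃ : Fin 3 → ℝ)
    (hv₁ : σ *ᵥ v₁ = lam1 σ • v₁) (hv₁u : v₁ ⬝ᵥ v₁ = 1)
    (hv₃ : σ *ᵥ v₃ = lam3 σ • v₃) (hv₃u : v₃ ⬝ᵥ v₃ = 1) :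
    (∃ L : Mat3 →L[ℝ] ℝ,
      HasFDerivWithinAt fTresca L {A : Mat3 | A.IsSymm} σ ∧
      ∀ τ : Mat3, L τ = (v₁ ⬝ᵥ (τ *ᵥ v₁) - v₃ ⬝ᵥ (τ *ᵥ v₃)) / 2) ∧
    minner ((1 / 2 : ℝ) • (vecMulVec v₁ v₁ - vecMulVec v₃ v₃))
        ((1 / 2 : ℝ) • (vecMulVec v₁ v₁ - vecMulVec v₃ v₃)) = 1 / 2 := by
  have hvw : v₁ ⬝ᵥ v₃ = 0 := by
    have h := symm_swap hσ v₁ v₃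
    rw [hv₁, hv₃, dotProduct_smul, dotProduct_smul, dotProduct_comm v₃ v₁, smul_eq_mul,
      smul_eq_mul] at h
    have h' : (lam1 σ - lam3 σ) * (v₁ ⬝ᵥ v₃) = 0 := by linarith
    exact (mul_eq_zero.1 h').resolve_left (by linarith)
  refine ⟨⟨(1 / 2 : ℝ) • (quadL v₁ - quadL v₃), ?_, ?_⟩, grad_norm hv₁u hv₃u hvw⟩
  · have h := ((lam1_deriv hσ h12 hv₁ hv₁u).sub (lam3_deriv hσ h23 hv₃ hv₃u)).const_smul
      (1 / 2 : ℝ)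
    refine h.congr_of_eventuallyEq (Filter.Eventually.of_forall fun A => ?_) ?_ <;>
    · simp [fTresca]
      ring
  · intro τ
    show (1 / 2 : ℝ) * (quadL v₁ τ - quadL v₃ τ) = _
    rw [quadL_apply, quadL_apply]
    ring
end
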